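/- For every k ≥ 2, if 𝔳^g_{k+1} < 𝔳^g_k then 𝔏_{k+1} < 𝔏_k. -/

import Mathlib

/-- A tree: a set of finite sequences of naturals closed under initial segments. -/
def IsTree (T : Set (List ℕ)) : Prop :=
  ∀ σ ∈ T, ∀ n : ℕ, σ.take n ∈ T

/-- The immediate successors of a node `σ` within `T`. -/
def succs (T : Set (List ℕ)) (σ : List ℕ) : Set ℕ :=
  {m : ℕ | σ ++ [m] ∈ T}

/-- A `k`-tree: a tree in which every node has at least `1` and at most `k`
immediate successors. -/
def IsKTree (k : ℕ) (T : Set (List ℕ)) : Prop :=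
  IsTree T ∧ ∀ σ ∈ T, 1 ≤ (succs T σ).encard ∧ (succs T σ).encard ≤ k

/-- The initial segment `f↾n = ⟨f 0, …, f (n-1)⟩`. -/
def seg (f : ℕ → ℕ) (n : ℕ) : List ℕ :=
  List.ofFn fun i : Fin n => f i

/-- `f` is a branch of `T` if all its finite initial segments belong to `T`. -/
def IsBranch (T : Set (List ℕ)) (f : ℕ → ℕ) : Prop :=
  ∀ n : ℕ, seg f n ∈ T

/-- A `k` globally adaptive predictor: a sequence `⟨π_n : n ∈ ℕ⟩` of functions,
where `π_n` assigns to each sequence `s ∈ ℕ^n` a `k`-element set of naturals. -/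
structure Predictor (k : ℕ) where
  π : (n : ℕ) → (Fin n → ℕ) → Finset ℕ
  card_π : ∀ n s, (π n s).card = k

/-- `f` is predicted by `p` if from some point on, `f n ∈ π_n (f↾n)`. -/
def Predicts {k : ℕ} (p : Predictor k) (f : ℕ → ℕ) : Prop :=
  ∃ m : ℕ, ∀ n : ℕ, m < n → f n ∈ p.π n fun i : Fin n => f i

/-- A `k`-branching tree: a tree in which every node has either exactly `1` or
exactly `k` immediate successors. -/
def IsKBranching (k : ℕ) (T : Set (List ℕ)) : Prop :=
  IsTree T ∧ ∀ σ ∈ T, (succs T σ).encard = 1 ∨ (succs T σ).encard = k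

/-- The prediction number `𝔳^g_k`: the smallest cardinality of a set of `k`
globally adaptive predictors predicting every `f : ℕ → ℕ`. -/
noncomputable def predNum (k : ℕ) : Cardinal :=
  sInf {c : Cardinal | ∃ P : Set (Predictor k), Cardinal.mk P = c ∧
    ∀ f : ℕ → ℕ, ∃ p ∈ P, Predicts p f}

/-- The `k`-localization number `𝔏_k`: the smallest cardinality of a family of
`k`-branching trees such that every `f : ℕ → {0,…,k}` is a branch of one of them. -/
noncomputable def locNum (k : ℕ) : Cardinal :=
  sInf {c : Cardinal | ∃ 𝒯 : Set (Set (List ℕ)), Cardinal.mk 𝒯 = c ∧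
    (∀ T ∈ 𝒯, IsKBranching k T) ∧
    ∀ f : ℕ → ℕ, (∀ n, f n ≤ k) → ∃ T ∈ 𝒯, IsBranch T f}

theorem seg_succ (f : ℕ → ℕ) (n : ℕ) : seg f (n + 1) = seg f n ++ [f n] := by
  rw [seg, List.ofFn_succ_last]
  rfl

theorem seg_length (f : ℕ → ℕ) (n : ℕ) : (seg f n).length = n := by
  simp [seg]

theorem seg_getD (f : ℕ → ℕ) {n i : ℕ} (hi : i < n) : (seg f n).getD i 0 = f i := by
  simp [seg, List.getD, hi]

/-- The tree of sequences each of whose entries lies in the set `A` allows after the previous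
entries. -/
def treeOf (A : List ℕ → Set ℕ) : Set (List ℕ) :=
  {σ | ∀ τ x, τ ++ [x] <+: σ → x ∈ A τ}

theorem isTree_treeOf (A : List ℕ → Set ℕ) : IsTree (treeOf A) :=
  fun σ hσ n τ x h => hσ τ x (h.trans (List.take_prefix n σ))

theorem append_mem_treeOf {A : List ℕ → Set ℕ} {σ : List ℕ} (hσ : σ ∈ treeOf A) {y : ℕ} :
    σ ++ [y] ∈ treeOf A ↔ y ∈ A σ := by
  refine ⟨fun h => h σ y (List.prefix_refl _), fun hy τ x h => ?_⟩
  rcases List.prefix_concat_iff.1 h with h | h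
  · obtain ⟨rfl, h⟩ := List.append_inj' h rfl
    simp_all
  · exact hσ τ x h

theorem succs_treeOf {A : List ℕ → Set ℕ} {σ : List ℕ} (hσ : σ ∈ treeOf A) :
    succs (treeOf A) σ = A σ :=
  Set.ext fun _ => append_mem_treeOf hσ

theorem isBranch_treeOf {A : List ℕ → Set ℕ} {f : ℕ → ℕ} (h : ∀ n, f n ∈ A (seg f n)) :
    IsBranch (treeOf A) f := by
  intro n
  induction n with
  | zero => intro τ x h; simp [seg] at h
  | succ n ih => rw [seg_succ]; exact (append_mem_treeOf ih).2 (h n)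

/-- The values allowed after `τ`: those of `s` along `s`, and the predicted ones afterwards. -/
def Predictor.allowed {k : ℕ} (p : Predictor k) (s τ : List ℕ) : Set ℕ :=
  if τ.length < s.length then {s.getD τ.length 0}
  else p.π τ.length fun i => τ.getD i 0

theorem Predictor.isKBranching_treeOf_allowed {k : ℕ} (p : Predictor k) (s : List ℕ) :
    IsKBranching k (treeOf (p.allowed s)) := by
  refine ⟨isTree_treeOf _, fun σ hσ => ?_⟩
  rw [succs_treeOf hσ, Predictor.allowed]
  split_ifs
  · simp
  · right
    rw [Set.encard_coe_eq_coe_finsetCard, p.card_π]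

theorem Predictor.π_seg {k : ℕ} (p : Predictor k) (f : ℕ → ℕ) (n : ℕ) :
    (p.π (seg f n).length fun i => (seg f n).getD i 0) = p.π n fun i => f i := by
  have key : ∀ m, m = n → (p.π m fun i => (seg f n).getD i 0) = p.π n fun i => f i := by
    rintro m rfl
    congr 1
    funext i
    exact seg_getD f i.2
  exact key _ (seg_length f n)

theorem Predicts.exists_isBranch {k : ℕ} {p : Predictor k} {f : ℕ → ℕ} (h : Predicts p f) :
    ∃ s, IsBranch (treeOf (p.allowed s)) f := by
  obtain ⟨m, hm⟩ := h
  refine ⟨seg f (m + 1), isBranch_treeOf fun n => ?_⟩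
  rw [Predictor.allowed, p.π_seg, seg_length, seg_length]
  split_ifs with hn
  · rw [seg_getD f hn]; rfl
  · exact hm n (by omega)

theorem exists_predictor (k : ℕ) (A : (n : ℕ) → (Fin n → ℕ) → Finset ℕ) :
    ∃ q : Predictor k, ∀ n s, (A n s).card ≤ k → A n s ⊆ q.π n s := by
  have (n : ℕ) (s : Fin n → ℕ) : ∃ B : Finset ℕ, B.card = k ∧ ((A n s).card ≤ k → A n s ⊆ B) := by
    by_cases h : (A n s).card ≤ k
    · obtain ⟨B, hB, hc⟩ := Infinite.exists_superset_card_eq (A n s) k h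
      exact ⟨B, hc, fun _ => hB⟩
    · exact ⟨Finset.range k, by simp, fun h' => absurd h' h⟩
  choose B hB hA using this
  exact ⟨⟨B, hB⟩, hA⟩

theorem exists_predicts {k : ℕ} (hk : 1 ≤ k) (f : ℕ → ℕ) : ∃ p : Predictor k, Predicts p f := by
  obtain ⟨q, hq⟩ := exists_predictor k fun n _ => {f n}
  exact ⟨q, 0, fun n _ => hq n _ (by simpa using hk) (by simp)⟩

theorem exists_mk_eq_predNum {k : ℕ} (hk : 1 ≤ k) :
    ∃ P : Set (Predictor k), Cardinal.mk P = predNum k ∧ ∀ f : ℕ → ℕ, ∃ p ∈ P, Predicts p f := by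
  refine csInf_mem (s := {c : Cardinal | ∃ P : Set (Predictor k), Cardinal.mk P = c ∧
    ∀ f : ℕ → ℕ, ∃ p ∈ P, Predicts p f}) ⟨_, Set.univ, rfl, fun f => ?_⟩
  simpa using exists_predicts hk f

theorem exists_localizing_family {k : ℕ} {P : Set (Predictor k)}
    (hP : ∀ f : ℕ → ℕ, ∃ p ∈ P, Predicts p f) :
    ∃ 𝒯 : Set (Set (List ℕ)), Cardinal.mk 𝒯 ≤ Cardinal.mk P * Cardinal.aleph0 ∧
      (∀ T ∈ 𝒯, IsKBranching k T) ∧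
      ∀ f : ℕ → ℕ, (∀ n, f n ≤ k) → ∃ T ∈ 𝒯, IsBranch T f := by
  refine ⟨Set.range fun x : P × List ℕ => treeOf (Predictor.allowed x.1.1 x.2), ?_, ?_, fun f _ => ?_⟩
  · refine Cardinal.mk_range_le.trans ?_
    rw [Cardinal.mk_prod, Cardinal.lift_id, Cardinal.lift_id]
    exact mul_le_mul_right Cardinal.mk_le_aleph0 _
  · rintro _ ⟨x, rfl⟩
    exact Predictor.isKBranching_treeOf_allowed x.1.1 x.2
  · obtain ⟨p, hp, hf⟩ := hP f
    obtain ⟨s, hs⟩ := hf.exists_isBranch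
    exact ⟨_, ⟨(⟨p, hp⟩, s), rfl⟩, hs⟩

theorem locNum_le_predNum_mul_aleph0 {k : ℕ} (hk : 1 ≤ k) :
    locNum k ≤ predNum k * Cardinal.aleph0 := by
  obtain ⟨P, hc, hP⟩ := exists_mk_eq_predNum hk
  obtain ⟨𝒯, h𝒯, h⟩ := exists_localizing_family hP
  have hle : locNum k ≤ Cardinal.mk 𝒯 := csInf_le' ⟨𝒯, rfl, h⟩
  exact hle.trans (hc ▸ h𝒯)

theorem exists_mk_eq_locNum {k : ℕ} (hk : 1 ≤ k) :
    ∃ 𝒯 : Set (Set (List ℕ)), Cardinal.mk 𝒯 = locNum k ∧ (∀ T ∈ 𝒯, IsKBranching k T) ∧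
      ∀ f : ℕ → ℕ, (∀ n, f n ≤ k) → ∃ T ∈ 𝒯, IsBranch T f := by
  obtain ⟨P, -, hP⟩ := exists_mk_eq_predNum hk
  obtain ⟨𝒯, -, h⟩ := exists_localizing_family hP
  exact csInf_mem (s := {c : Cardinal | ∃ 𝒯 : Set (Set (List ℕ)), Cardinal.mk 𝒯 = c ∧
    (∀ T ∈ 𝒯, IsKBranching k T) ∧
    ∀ f : ℕ → ℕ, (∀ n, f n ≤ k) → ∃ T ∈ 𝒯, IsBranch T f}) ⟨_, 𝒯, rfl, h⟩

/-- A function escaping finitely many predictors. -/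
noncomputable def escape {k : ℕ} (F : Finset (Predictor k)) : ℕ → ℕ
  | n => (Infinite.exists_notMem_finset
      (F.biUnion fun p => p.π n fun i : Fin n => have := i.isLt; escape F i)).choose

theorem escape_notMem {k : ℕ} {F : Finset (Predictor k)} {p : Predictor k} (hp : p ∈ F) (n : ℕ) :
    escape F n ∉ p.π n fun i => escape F i := by
  intro h
  have := (Infinite.exists_notMem_finset (F.biUnion fun p => p.π n fun i => escape F i)).choose_spec
  rw [escape] at h
  exact this (Finset.mem_biUnion.2 ⟨p, hp, h⟩)

theorem aleph0_le_predNum {k : ℕ} (hk : 1 ≤ k) : Cardinal.aleph0 ≤ predNum k := by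
  obtain ⟨P, hc, hP⟩ := exists_mk_eq_predNum hk
  rw [← hc]
  by_contra! hfin
  have hfin : P.Finite := Cardinal.lt_aleph0_iff_set_finite.1 hfin
  obtain ⟨p, hp, m, hm⟩ := hP (escape hfin.toFinset)
  exact escape_notMem (hfin.mem_toFinset.2 hp) _ (hm (m + 1) m.lt_succ_self)

theorem exists_le_injOn {k : ℕ} {A : Finset ℕ} (hA : A.card = k + 1) :
    ∃ e : ℕ → ℕ, (∀ x, e x ≤ k) ∧ Set.InjOn e A := by
  refine ⟨fun x => if hx : x ∈ A then A.equivFinOfCardEq hA ⟨x, hx⟩ else 0, fun x => ?_, ?_⟩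
  · dsimp only
    split_ifs
    · omega
    · omega
  · intro x hx y hy h
    have hx : x ∈ A := hx
    have hy : y ∈ A := hy
    simpa [hx, hy, Fin.val_inj] using h

/-- A `(k + 1)`-predictor maps the functions it predicts to functions bounded by `k`, and
`k`-branching trees pull back along this map to `k`-predictors. -/
theorem exists_predictor_pullback {k : ℕ} (hk : 1 ≤ k) (p : Predictor (k + 1)) :
    ∃ g : (ℕ → ℕ) → ℕ → ℕ, (∀ f n, g f n ≤ k) ∧ ∀ T, IsKBranching k T →
      ∃ q : Predictor k, ∀ f, Predicts p f → IsBranch T (g f) → Predicts q f := by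
  classical
  choose e he hinj using fun n s => exists_le_injOn (p.card_π n s)
  refine ⟨fun f n => e n (fun i => f i) (f n), fun f n => he _ _ _, fun T hT => ?_⟩
  obtain ⟨q, hq⟩ := exists_predictor k fun n s => (p.π n s).filter fun x =>
    (List.ofFn fun i : Fin n => e i (fun j => s ⟨j, j.isLt.trans i.isLt⟩) (s i)) ++ [e n s x] ∈ T
  refine ⟨q, fun f ⟨m, hm⟩ hf => ⟨m, fun n hn => hq n _ ?_ ?_⟩⟩
  · set g : ℕ → ℕ := fun n => e n (fun i => f i) (f n)
    have hle : (succs T (seg g n)).encard ≤ k := by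
      rcases hT.2 _ (hf n) with h | h
      · rw [h]; exact_mod_cast hk
      · exact h.le
    rw [← Nat.cast_le (α := ℕ∞), ← Set.encard_coe_eq_coe_finsetCard]
    refine le_trans (Set.encard_le_encard_of_injOn (t := succs T (seg g n))
      (f := e n fun i => f i) ?_ ?_) hle
    · intro x hx
      exact (Finset.mem_filter.1 hx).2
    · exact (hinj n _).mono fun x hx => (Finset.mem_filter.1 hx).1
  · refine Finset.mem_filter.2 ⟨hm n hn, ?_⟩
    have := hf (n + 1)
    rwa [seg_succ] at this

theorem predNum_le_predNum_succ_mul_locNum {k : ℕ} (hk : 1 ≤ k) :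
    predNum k ≤ predNum (k + 1) * locNum k := by
  obtain ⟨P, hPc, hP⟩ := exists_mk_eq_predNum (k := k + 1) (by omega)
  obtain ⟨𝒯, h𝒯c, h𝒯, hb⟩ := exists_mk_eq_locNum hk
  choose g hg hq using fun p : Predictor (k + 1) => exists_predictor_pullback hk p
  choose q hq using hq
  have : predNum k ≤ Cardinal.mk (Set.range fun x : P × 𝒯 => q x.1 x.2 (h𝒯 _ x.2.2)) := by
    refine csInf_le' ⟨_, rfl, fun f => ?_⟩
    obtain ⟨p, hp, hpf⟩ := hP f
    obtain ⟨T, hT, hTf⟩ := hb (g p f) (hg p f)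
    exact ⟨_, ⟨(⟨p, hp⟩, ⟨T, hT⟩), rfl⟩, hq p T (h𝒯 T hT) f hpf hTf⟩
  refine this.trans (Cardinal.mk_range_le.trans ?_)
  rw [← hPc, ← h𝒯c]
  simp

theorem stmt15 (k : ℕ) (hk : 2 ≤ k) (h : predNum (k + 1) < predNum k) :
    locNum (k + 1) < locNum k := by
  have hinf : Cardinal.aleph0 ≤ predNum (k + 1) := aleph0_le_predNum (by omega)
  have hle : locNum (k + 1) ≤ predNum (k + 1) :=
    (locNum_le_predNum_mul_aleph0 (by omega)).trans (Cardinal.mul_aleph0_eq hinf).le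
  by_contra! hcon
  refine h.not_ge ((predNum_le_predNum_succ_mul_locNum (by omega)).trans ?_)
  exact Cardinal.mul_le_of_le hinf le_rfl (hcon.trans hle)
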